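/- arXiv:1409.5396 — 2 statements merged into one kernel-verified Lean document; each statement's English description precedes it below -/
import Mathlib

section
/- For every s ≥ 1 and n ≥ 1, the number of closed walks of length 2s on Fin n that visit exactly s+1 distinct vertices and traverse each of their edges at least twice equals n·(n−1)⋯(n−s)·C_s; that is, the cardinality of Ŵ_{2s,s+1}^{(n)} equals Nat.descFactorial n (s+1) · Nat.catalan s, where C_s = (1/(s+1))·binom(2s, s) is the s-th Catalan number. -/
/-- Number of times the closed walk `w : ZMod k → Fin n` traverses the unordered edge `e`. -/
noncomputable def edgeCount (k n : ℕ) (e : Sym2 (Fin n)) (w : ZMod k → Fin n) : ℕ :=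
  Nat.card {j : ZMod k // s(w j, w (j + 1)) = e}

/-- Closed walks of length `k` on `Fin n` visiting exactly `p` distinct vertices. -/
def Wset (k n p : ℕ) : Set (ZMod k → Fin n) := {w | Nat.card (Set.range w) = p}

/-- Walks in `Wset k n p` that traverse each of their edges at least twice. -/
def WhatSet (k n p : ℕ) : Set (ZMod k → Fin n) :=
  {w ∈ Wset k n p | ∀ e : Sym2 (Fin n), 1 ≤ edgeCount k n e w → 2 ≤ edgeCount k n e w}

/-- The edges traversed by the walk that starts at `x` and then visits the vertices of a list. -/
def walkEdges {α : Type*} : α → List α → List (Sym2 α)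
  | _, [] => []
  | x, y :: u => s(x, y) :: walkEdges y u

/-- A walk continuing from the vertex `x`, when the vertices of `A` have already been visited and
`st` is the path from the parent of `x` to the root, is a depth-first walk if each step either
discovers a new vertex or returns to the parent, and the walk ends at the root. -/
def IsDepthFirst {α : Type*} [DecidableEq α] : α → List α → Finset α → List α → Prop
  | _, st, _, [] => st = []
  | x, st, A, y :: u =>
    (y ∉ A ∧ IsDepthFirst y (x :: st) (insert y A) u) ∨
      (y ∈ A ∧ ∃ st', st = y :: st' ∧ IsDepthFirst y st' A u)

/-- Ballot numbers: the number of nonnegative lattice paths from height `h` to height `0` with `u`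
up-steps. -/
def ballot : ℕ → ℕ → ℕ
  | 0, _ => 1
  | u + 1, 0 => ballot u 1
  | u + 1, h + 1 => ballot u (h + 2) + ballot (u + 1) h

theorem ballot_add_choose (u h : ℕ) :
    ballot (u + 1) h + (2 * u + h + 2).choose u = (2 * u + h + 2).choose (u + 1) := by
  induction u generalizing h with
  | zero =>
    induction h with
    | zero => simp [ballot]
    | succ h ih => simp [ballot] at ih ⊢; omega
  | succ v ihv =>
    induction h with
    | zero =>
      have h1 := ihv 1
      have h2 : (2 * v + 3).choose (v + 2) = (2 * v + 3).choose (v + 1) :=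
        Nat.choose_symm_of_eq_add (by omega)
      have h3 := Nat.choose_succ_succ (2 * v + 3) v
      have h4 := Nat.choose_succ_succ (2 * v + 3) (v + 1)
      simp only [ballot, Nat.succ_eq_add_one, Nat.mul_add, add_assoc, Nat.reduceAdd, add_zero,
        Nat.mul_one] at *
      omega
    | succ h ih =>
      have h1 := ihv (h + 2)
      have h3 := Nat.choose_succ_succ (2 * v + h + 4) v
      have h4 := Nat.choose_succ_succ (2 * v + h + 4) (v + 1)
      rw [ballot]
      rw [show 2 * (v + 1) + h + 2 = 2 * v + h + 4 by ring] at ih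
      rw [show 2 * v + (h + 2) + 2 = 2 * v + h + 4 by ring] at h1
      rw [show 2 * (v + 1) + (h + 1) + 2 = 2 * v + h + 4 + 1 by ring]
      simp only [Nat.succ_eq_add_one] at *
      omega

theorem ballot_zero_right (u : ℕ) : ballot u 0 = catalan u := by
  cases u with
  | zero => simp [ballot]
  | succ u =>
    have h1 := ballot_add_choose u 0
    have h2 := succ_mul_catalan_eq_centralBinom (u + 1)
    have h3 := Nat.choose_succ_right_eq (2 * u + 2) u
    rw [Nat.centralBinom, show 2 * (u + 1) = 2 * u + 2 by ring] at h2
    rw [show 2 * u + 2 - u = u + 2 by omega] at h3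
    rw [add_zero] at h1
    have : (u + 2) * ballot (u + 1) 0 = (u + 2) * catalan (u + 1) := by
      nlinarith
    exact Nat.eq_of_mul_eq_mul_left (by omega) this

section Walks

variable {α : Type*}

@[simp]
theorem length_walkEdges (x : α) (u : List α) : (walkEdges x u).length = u.length := by
  induction u generalizing x with
  | nil => rfl
  | cons y u ih => simp [walkEdges, ih]

theorem mem_of_mem_walkEdges {x a b : α} {u : List α} (h : s(a, b) ∈ walkEdges x u) :
    a ∈ x :: u := by
  induction u generalizing x with
  | nil => simp [walkEdges] at h
  | cons y u ih =>
    simp only [walkEdges, List.mem_cons, Sym2.eq_iff] at h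
    rcases h with (⟨rfl, rfl⟩ | ⟨rfl, rfl⟩) | h
    · simp
    · simp
    · exact List.mem_cons_of_mem _ (ih h)

theorem nodup_walkEdges {x : α} {u : List α} (h : (x :: u).Nodup) : (walkEdges x u).Nodup := by
  induction u generalizing x with
  | nil => simp [walkEdges]
  | cons y u ih =>
    rw [List.nodup_cons] at h
    exact List.nodup_cons.2 ⟨fun h' => h.1 (mem_of_mem_walkEdges h'), ih h.2⟩

theorem exists_eq_cons_of_mem_walkEdges {x y : α} {st : List α} (h : (x :: st).Nodup)
    (hy : s(x, y) ∈ walkEdges x st) : ∃ st', st = y :: st' := by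
  cases st with
  | nil => simp [walkEdges] at hy
  | cons z st =>
    rw [List.nodup_cons] at h
    rcases List.mem_cons.1 hy with hy | hy
    · obtain rfl : y = z := Sym2.congr_right.1 hy
      exact ⟨st, rfl⟩
    · exact absurd (mem_of_mem_walkEdges hy) h.1

theorem walkEdges_ofFn (h : ℕ → α) (m : ℕ) :
    walkEdges (h 0) (List.ofFn fun i : Fin m => h (i + 1)) =
      List.ofFn fun i : Fin m => s(h i, h (i + 1)) := by
  induction m generalizing h with
  | zero => rfl
  | succ m ih =>
    simp only [List.ofFn_succ, walkEdges, Fin.val_zero, Fin.val_succ, zero_add]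
    exact congrArg _ (ih fun i => h (i + 1))

variable [DecidableEq α]

theorem card_toFinset_cons_sdiff {y : α} {A : Finset α} (hy : y ∉ A) (u : List α) :
    ((y :: u).toFinset \ A).card = (u.toFinset \ insert y A).card + 1 := by
  rw [← Finset.card_insert_of_notMem (a := y) (by simp)]
  congr 1
  ext v
  by_cases hv : v = y <;> simp [hv, hy]

/-- The edges along which a walk discovers new vertices are distinct. -/
theorem exists_discovery_edges (x : α) (A : Finset α) (hx : x ∈ A) (u : List α) :
    ∃ D : Finset (Sym2 α), D.card = (u.toFinset \ A).card ∧
      ∀ e ∈ D, e ∈ walkEdges x u ∧ ∃ v ∈ e, v ∉ A := by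
  induction u generalizing x A with
  | nil => exact ⟨∅, by simp⟩
  | cons y u ih =>
    by_cases hy : y ∈ A
    · obtain ⟨D, hD, h⟩ := ih y A hy
      refine ⟨D, ?_, fun e he => ⟨List.mem_cons_of_mem _ (h e he).1, (h e he).2⟩⟩
      rw [hD, List.toFinset_cons, Finset.insert_sdiff_of_mem _ hy]
    · obtain ⟨D, hD, h⟩ := ih y (insert y A) (Finset.mem_insert_self _ _)
      refine ⟨insert s(x, y) D, ?_, ?_⟩
      · rw [Finset.card_insert_of_notMem, hD, card_toFinset_cons_sdiff hy]
        intro he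
        obtain ⟨v, hv, hvA⟩ := (h _ he).2
        rcases Sym2.mem_iff.1 hv with rfl | rfl <;> simp [hx] at hvA
      · intro e he
        rcases Finset.mem_insert.1 he with rfl | he
        · exact ⟨List.mem_cons_self, y, Sym2.mem_mk_right _ _, hy⟩
        · obtain ⟨h1, v, hv, hvA⟩ := h e he
          exact ⟨List.mem_cons_of_mem _ h1, v, hv, fun h' => hvA (Finset.mem_insert_of_mem h')⟩

theorem IsDepthFirst.length_eq {x : α} {st : List α} {A : Finset α} {u : List α}
    (h : IsDepthFirst x st A u) : u.length = 2 * (u.toFinset \ A).card + st.length := by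
  induction u generalizing x st A with
  | nil =>
    obtain rfl : st = [] := h
    simp
  | cons y u ih =>
    rcases h with ⟨hy, h⟩ | ⟨hy, st', rfl, h⟩
    · have := ih h
      rw [card_toFinset_cons_sdiff hy]
      simp only [List.length_cons] at *
      omega
    · have := ih h
      rw [List.toFinset_cons, Finset.insert_sdiff_of_mem _ hy]
      simp only [List.length_cons] at *
      omega

theorem IsDepthFirst.two_le_count {x : α} {st : List α} {A : Finset α} {u : List α}
    (h : IsDepthFirst x st A u) {e : Sym2 α} (he : e ∈ walkEdges x st ++ walkEdges x u) :
    2 ≤ (walkEdges x st ++ walkEdges x u).count e := by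
  induction u generalizing x st A with
  | nil =>
    obtain rfl : st = [] := h
    simp [walkEdges] at he
  | cons y u ih =>
    rcases h with ⟨hy, h⟩ | ⟨hy, st', rfl, h⟩
    · have hp : (walkEdges x st ++ walkEdges x (y :: u)).Perm
          (walkEdges y (x :: st) ++ walkEdges y u) := by
        simp only [walkEdges, Sym2.eq_swap (a := y) (b := x)]
        exact List.perm_middle
      rw [hp.count_eq]
      exact ih h (hp.mem_iff.1 he)
    · have := @ih y st' A h
      simp only [walkEdges, List.mem_append, List.mem_cons, List.count_append,
        List.count_cons] at *
      by_cases hxy : s(x, y) = e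
      · simp [hxy]; omega
      · have : e ∈ walkEdges y st' ∨ e ∈ walkEdges y u := by grind
        grind

theorem IsDepthFirst.getLast_eq {x : α} {st : List α} {A : Finset α} {u : List α}
    (h : IsDepthFirst x st A u) :
    (x :: u).getLast (by simp) = (x :: st).getLast (by simp) := by
  induction u generalizing x st A with
  | nil =>
    obtain rfl : st = [] := h
    rfl
  | cons y u ih =>
    rcases h with ⟨hy, h⟩ | ⟨hy, st', rfl, h⟩
    · simpa using ih h
    · simpa using ih h

/-- A walk that is as short as the number of its vertices allows, and that traverses every edge of
the path `x :: st` and every edge to a new vertex at least twice, is a depth-first walk. -/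
theorem isDepthFirst_of_two_le_count {x : α} {st : List α} {A : Finset α} {u : List α}
    (hst : (x :: st).Nodup) (hA : ∀ v ∈ x :: st, v ∈ A)
    (hlen : u.length = 2 * (u.toFinset \ A).card + st.length)
    (hst2 : ∀ e ∈ walkEdges x st, 2 ≤ (walkEdges x st ++ walkEdges x u).count e)
    (hu2 : ∀ e ∈ walkEdges x u, (∃ v ∈ e, v ∉ A) →
      2 ≤ (walkEdges x st ++ walkEdges x u).count e) :
    IsDepthFirst x st A u := by
  induction u generalizing x st A with
  | nil => exact List.length_eq_zero_iff.1 (by simpa using hlen.symm)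
  | cons y u ih =>
    by_cases hy : y ∈ A
    · have hmem : s(x, y) ∈ walkEdges x st := by
        by_contra hxy
        obtain ⟨D, hD, h⟩ := exists_discovery_edges x A (hA x List.mem_cons_self) (y :: u)
        set L := walkEdges x st ++ walkEdges x (y :: u) with hL
        set S := (walkEdges x st).toFinset with hS
        have hSc : S.card = st.length := by
          rw [hS, List.toFinset_card_of_nodup (nodup_walkEdges hst), length_walkEdges]
        have hstA : ∀ e ∈ S, ∀ v ∈ e, v ∈ A := by
          intro e he v hv
          obtain ⟨w, rfl⟩ := Sym2.mem_iff_exists.1 hv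
          exact hA v (mem_of_mem_walkEdges (List.mem_toFinset.1 he))
        have hdisj : Disjoint S D := by
          refine Finset.disjoint_left.2 fun e heS heD => ?_
          obtain ⟨v, hv, hvA⟩ := (h e heD).2
          exact hvA (hstA e heS v hv)
        have hnot : s(x, y) ∉ S ∪ D := by
          rw [Finset.mem_union, not_or]
          refine ⟨fun h' => hxy (List.mem_toFinset.1 h'), fun h' => ?_⟩
          obtain ⟨v, hv, hvA⟩ := (h _ h').2
          rcases Sym2.mem_iff.1 hv with rfl | rfl
          · exact hvA (hA _ List.mem_cons_self)
          · exact hvA hy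
        have hsub : insert s(x, y) (S ∪ D) ⊆ L.toFinset := by
          intro e he
          rw [List.mem_toFinset, hL, List.mem_append]
          rcases Finset.mem_insert.1 he with rfl | he
          · exact Or.inr List.mem_cons_self
          · rcases Finset.mem_union.1 he with he | he
            · exact Or.inl (List.mem_toFinset.1 he)
            · exact Or.inr (h e he).1
        have hle := Finset.sum_le_sum_of_subset (f := fun e => L.count e) hsub
        rw [List.sum_toFinset_count_eq_length, Finset.sum_insert hnot] at hle
        have h1 : 0 < L.count s(x, y) := List.count_pos_iff.2
          (List.mem_append_right _ List.mem_cons_self)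
        have h2 : (S ∪ D).card * 2 ≤ ∑ e ∈ S ∪ D, L.count e := by
          refine Finset.card_nsmul_le_sum (S ∪ D) (fun e => L.count e) 2 fun e he => ?_
          rcases Finset.mem_union.1 he with he | he
          · exact hst2 e (List.mem_toFinset.1 he)
          · exact hu2 e (h e he).1 (h e he).2
        rw [Finset.card_union_of_disjoint hdisj, hSc, hD] at h2
        have hLc : L.length = st.length + (u.length + 1) := by simp [hL]
        rw [List.length_cons] at hlen
        omega
      obtain ⟨st, rfl⟩ := exists_eq_cons_of_mem_walkEdges hst hmem
      refine Or.inr ⟨hy, st, rfl, ?_⟩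
      have hne : ∀ e, e ≠ s(x, y) →
          (walkEdges x (y :: st) ++ walkEdges x (y :: u)).count e =
            (walkEdges y st ++ walkEdges y u).count e := by
        intro e he
        simp [walkEdges, List.count_append, he.symm]
      rw [List.nodup_cons] at hst
      refine ih hst.2 (fun v hv => hA v (List.mem_cons_of_mem _ hv)) ?_ ?_ ?_
      · rw [List.toFinset_cons, Finset.insert_sdiff_of_mem _ hy] at hlen
        simp only [List.length_cons] at hlen
        omega
      · intro e he
        rw [← hne e]
        · exact hst2 e (List.mem_cons_of_mem _ he)
        · rintro rfl
          exact hst.1 (mem_of_mem_walkEdges he)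
      · rintro e he ⟨v, hv, hvA⟩
        rw [← hne e]
        · exact hu2 e (List.mem_cons_of_mem _ he) ⟨v, hv, hvA⟩
        · rintro rfl
          rcases Sym2.mem_iff.1 hv with rfl | rfl
          · exact hvA (hA _ List.mem_cons_self)
          · exact hvA hy
    · have hp : (walkEdges x st ++ walkEdges x (y :: u)).Perm
          (walkEdges y (x :: st) ++ walkEdges y u) := by
        simp only [walkEdges, Sym2.eq_swap (a := y) (b := x)]
        exact List.perm_middle
      have hxy : ∃ v ∈ s(x, y), v ∉ A := ⟨y, Sym2.mem_mk_right _ _, hy⟩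
      refine Or.inl ⟨hy, ih ?_ ?_ ?_ ?_ ?_⟩
      · exact List.nodup_cons.2 ⟨fun h => hy (hA y h), hst⟩
      · intro v hv
        rcases List.mem_cons.1 hv with rfl | hv
        · exact Finset.mem_insert_self _ _
        · exact Finset.mem_insert_of_mem (hA v hv)
      · rw [card_toFinset_cons_sdiff hy] at hlen
        simp only [List.length_cons] at *
        omega
      · intro e he
        rw [← hp.count_eq]
        rcases List.mem_cons.1 he with rfl | he
        · rw [Sym2.eq_swap]
          exact hu2 _ List.mem_cons_self hxy
        · exact hst2 e he
      · rintro e he ⟨v, hv, hvA⟩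
        rw [← hp.count_eq]
        exact hu2 e (List.mem_cons_of_mem _ he)
          ⟨v, hv, fun h => hvA (Finset.mem_insert_of_mem h)⟩

/-- A closed walk of length `2 * s` is depth-first iff it visits `s + 1` vertices and traverses
each of its edges at least twice. -/
theorem isDepthFirst_nil_iff {x : α} {u : List α} {s : ℕ} (hu : u.length = 2 * s) (hx : x ∈ u) :
    IsDepthFirst x [] {x} u ↔
      u.toFinset.card = s + 1 ∧ ∀ e ∈ walkEdges x u, 2 ≤ (walkEdges x u).count e := by
  have hc := Finset.card_sdiff_add_card_eq_card
    (Finset.singleton_subset_iff.2 (List.mem_toFinset.2 hx))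
  rw [Finset.card_singleton] at hc
  constructor
  · intro h
    have := h.length_eq
    rw [List.length_nil] at this
    exact ⟨by omega, fun e he => h.two_le_count he⟩
  · rintro ⟨h1, h2⟩
    refine isDepthFirst_of_two_le_count (by simp) (by simp) ?_ (by simp [walkEdges])
      fun e he _ => h2 e he
    rw [List.length_nil]
    omega

/-- The number of depth-first walks of given length. -/
theorem card_isDepthFirst [Fintype α] (m k : ℕ) (x : α) (st : List α) (A : Finset α)
    (hst : ∀ v ∈ x :: st, v ∈ A) (hm : m = 2 * k + st.length) :
    Nat.card {g : Fin m → α // IsDepthFirst x st A (List.ofFn g)} =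
      (Fintype.card α - A.card).descFactorial k * ballot k st.length := by
  induction m generalizing k x st A with
  | zero =>
    obtain rfl : k = 0 := by omega
    obtain rfl : st = [] := List.length_eq_zero_iff.1 (by omega)
    simp [IsDepthFirst, ballot]
  | succ m ih =>
    have hsum : Nat.card {g : Fin (m + 1) → α // IsDepthFirst x st A (List.ofFn g)} =
        ∑ y, Nat.card {g : Fin m → α // IsDepthFirst x st A (y :: List.ofFn g)} := by
      rw [← Nat.card_sigma]
      refine Nat.card_congr (Equiv.trans ?_ (Equiv.subtypeProdEquivSigmaSubtype
        fun (y : α) (g : Fin m → α) => IsDepthFirst x st A (y :: List.ofFn g)))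
      refine (Equiv.subtypeEquiv (Fin.consEquiv fun _ => α) fun p => ?_).symm
      simp [Fin.consEquiv]
    have hnew : ∑ y ∈ Aᶜ, Nat.card {g : Fin m → α // IsDepthFirst x st A (y :: List.ofFn g)} =
        ∑ y ∈ Aᶜ, Nat.card
          {g : Fin m → α // IsDepthFirst y (x :: st) (insert y A) (List.ofFn g)} := by
      refine Finset.sum_congr rfl fun y hy => ?_
      simp [IsDepthFirst, Finset.mem_compl.1 hy]
    have hold : ∑ y ∈ A, Nat.card {g : Fin m → α // IsDepthFirst x st A (y :: List.ofFn g)} =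
        ∑ y ∈ A, Nat.card
          {g : Fin m → α // ∃ st', st = y :: st' ∧ IsDepthFirst y st' A (List.ofFn g)} := by
      refine Finset.sum_congr rfl fun y hy => ?_
      simp [IsDepthFirst, hy]
    rw [hsum, ← Finset.sum_add_sum_compl A, hold, hnew]
    have hpop : ∑ y ∈ A, Nat.card
        {g : Fin m → α // ∃ st', st = y :: st' ∧ IsDepthFirst y st' A (List.ofFn g)} =
          match (generalizing := false) st with
          | [] => 0
          | _ :: st => (Fintype.card α - A.card).descFactorial k * ballot k st.length := by
      cases st with
      | nil => simp
      | cons z st =>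
        rw [Finset.sum_eq_single_of_mem z (hst z (by simp))]
        · dsimp only
          rw [← ih k z st A (fun v hv => hst v (List.mem_cons_of_mem _ hv))
            (by rw [List.length_cons] at hm; omega)]
          simp
        · intro y _ hy
          simp [hy.symm]
    have hpush : ∑ y ∈ Aᶜ, Nat.card
        {g : Fin m → α // IsDepthFirst y (x :: st) (insert y A) (List.ofFn g)} =
          match (generalizing := false) k with
          | 0 => 0
          | k + 1 => (Fintype.card α - A.card).descFactorial (k + 1) *
              ballot k (st.length + 1) := by
      cases k with
      | zero =>
        refine Finset.sum_eq_zero fun y _ => ?_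
        rw [Nat.card_eq_zero]
        refine Or.inl ⟨fun g => ?_⟩
        have := g.2.length_eq
        rw [List.length_ofFn, List.length_cons] at this
        omega
      | succ k =>
        rw [Finset.sum_congr rfl fun y hy => ih k y (x :: st) (insert y A) (fun v hv => ?_)
          (by rw [List.length_cons]; omega)]
        · rw [Finset.sum_congr rfl fun y hy => by
            rw [Finset.card_insert_of_notMem (Finset.mem_compl.1 hy)]]
          rw [Finset.sum_const, Finset.card_compl, smul_eq_mul, ← mul_assoc, List.length_cons]
          congr 1
          cases h : Fintype.card α - A.card with
          | zero => simp
          | succ c =>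
            rw [Nat.succ_descFactorial_succ, show Fintype.card α - (A.card + 1) = c by omega]
        · rcases List.mem_cons.1 hv with rfl | hv
          · exact Finset.mem_insert_self _ _
          · exact Finset.mem_insert_of_mem (hst v hv)
    rw [hpop, hpush, add_comm]
    cases st <;> cases k <;> simp [ballot, mul_add] at hm ⊢

/-- Multiplicities in a list given by a function. -/
theorem count_ofFn {m : ℕ} (f : Fin m → α) (a : α) :
    (List.ofFn f).count a = Nat.card {i // f i = a} := by
  rw [Nat.card_eq_fintype_card, Fintype.card_subtype]
  induction m with
  | zero => simp
  | succ m ih =>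
    rw [List.ofFn_succ, List.count_cons, ih, Fin.card_filter_univ_succ]
    by_cases h : f 0 = a <;> simp [h]

end Walks

/-- The successors of the first `k` natural numbers enumerate `ZMod k`. -/
theorem bijective_natCast_add_one (k : ℕ) [NeZero k] :
    Function.Bijective fun i : Fin k => ((i + 1 : ℕ) : ZMod k) := by
  rw [Fintype.bijective_iff_injective_and_card, ZMod.card, Fintype.card_fin]
  refine ⟨fun i j h => ?_, rfl⟩
  simp only [Nat.cast_add, Nat.cast_one, add_left_inj] at h
  rw [ZMod.natCast_eq_natCast_iff', Nat.mod_eq_of_lt i.2, Nat.mod_eq_of_lt j.2] at h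
  exact Fin.ext h

theorem mem_WhatSet_and_eq_iff {k s n : ℕ} [NeZero k] (hk : k = 2 * s) (w : ZMod k → Fin n)
    (x : Fin n) :
    w ∈ WhatSet k n (s + 1) ∧ w 0 = x ↔
      IsDepthFirst x [] {x} (List.ofFn fun i : Fin k => w ((i + 1 : ℕ) : ZMod k)) := by
  set u := List.ofFn fun i : Fin k => w ((i + 1 : ℕ) : ZMod k) with hu
  have hbij := bijective_natCast_add_one k
  have hlast (h : (x :: u) ≠ []) : (x :: u).getLast h = w 0 := by
    obtain ⟨t, rfl⟩ : ∃ t, k = t + 1 := ⟨k - 1, by have := NeZero.pos k; omega⟩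
    have hne : u ≠ [] := by simp [hu]
    rw [List.getLast_cons hne]
    simp only [hu, List.getLast_ofFn]
    congr 1
    exact ZMod.natCast_self (t + 1)
  have hmem : ∀ v, v ∈ u ↔ v ∈ Set.range w := by
    intro v
    rw [hu, List.mem_ofFn', ← hbij.surjective.range_comp w]
    rfl
  have hcard : u.toFinset.card = Nat.card (Set.range w) := by
    have : (u.toFinset : Set (Fin n)) = Set.range w := by
      ext v
      simp [hmem]
    rw [← this, Nat.card_coe_set_eq, Set.ncard_coe_finset]
  have hedges : walkEdges (w 0) u =
      List.ofFn fun i : Fin k => s(w ((i : ℕ) : ZMod k), w ((i + 1 : ℕ) : ZMod k)) := by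
    simpa [hu] using walkEdges_ofFn (fun i => w ((i : ℕ) : ZMod k)) k
  have hcount : ∀ e, (walkEdges (w 0) u).count e = edgeCount k n e w := by
    intro e
    rw [hedges, count_ofFn, edgeCount]
    have hbij' : Function.Bijective fun i : Fin k => ((i : ℕ) : ZMod k) := by
      have := (Equiv.addRight (-1 : ZMod k)).bijective.comp hbij
      simpa [Function.comp_def] using this
    exact Nat.card_congr (Equiv.subtypeEquiv (Equiv.ofBijective _ hbij') fun i => by simp)
  have key : w ∈ WhatSet k n (s + 1) ↔ IsDepthFirst (w 0) [] {w 0} u := by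
    rw [isDepthFirst_nil_iff (s := s) (by simp [hu, hk]) ((hmem _).2 ⟨0, rfl⟩), hcard]
    simp only [← List.count_pos_iff, hcount]
    rfl
  constructor
  · rintro ⟨h, rfl⟩
    exact key.1 h
  · intro h
    obtain rfl : w 0 = x := by
      rw [← hlast (by simp), h.getLast_eq]
      rfl
    exact ⟨key.2 h, rfl⟩

/-- **Number of dominant walks**: `|Ŵ_{2s,s+1}| = n(n−1)⋯(n−s)·C_s`. -/
theorem card_dominant_walks (s n : ℕ) (hs : 1 ≤ s) (hn : 1 ≤ n) :
    Nat.card (WhatSet (2 * s) n (s + 1)) = Nat.descFactorial n (s + 1) * catalan s := by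
  have : NeZero (2 * s) := ⟨by omega⟩
  rw [← Nat.card_congr (Equiv.sigmaFiberEquiv fun w : WhatSet (2 * s) n (s + 1) => w.1 0),
    Nat.card_sigma]
  have h : ∀ x, Nat.card {w : WhatSet (2 * s) n (s + 1) // w.1 0 = x} =
      (n - 1).descFactorial s * catalan s := by
    intro x
    rw [← ballot_zero_right]
    have := card_isDepthFirst (2 * s) s x [] {x} (by simp) (by simp)
    rw [Fintype.card_fin, Finset.card_singleton, List.length_nil] at this
    rw [← this]
    refine Nat.card_congr ((Equiv.subtypeSubtypeEquivSubtypeInter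
      (· ∈ WhatSet (2 * s) n (s + 1)) (fun w => w 0 = x)).trans
      (Equiv.subtypeEquiv (Equiv.arrowCongr
        (Equiv.ofBijective _ (bijective_natCast_add_one (2 * s))).symm (Equiv.refl _)) fun w => ?_))
    exact mem_WhatSet_and_eq_iff rfl w x
  obtain ⟨n, rfl⟩ : ∃ n', n = n' + 1 := ⟨n - 1, by omega⟩
  rw [Nat.succ_descFactorial_succ, Finset.sum_congr rfl fun x _ => h x]
  simp [mul_assoc]
end

section
/- Let (Λ_k)_{k≥1} be positive reals such that there exists B > 0 with Λ_k ≤ B^k for all k ≥ 1, and let (m_k)_{k≥0} be the limiting moment sequence built from (Λ_k). Let (ν_n)_{n≥1} be probability measures on ℝ such that for every n and every k ≥ 1 the function x ↦ x^k is ν_n-integrable, and ∫ x^k dν_n(x) → m_k as n → ∞ for every k ≥ 1. Then there exists a unique probability measure F on ℝ with ∫ x^k dF(x) = m_k for all k ≥ 1, and ν_n converges weakly to F as n → ∞. -/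
open MeasureTheory Filter

/-- The index set `R_s` of degree distributions of trees with `s` edges. -/
def Rset (s : ℕ) : Finset (Fin s → ℕ) :=
  (Finset.Nat.antidiagonalTuple s (s + 1)).filter (fun r => ∑ j, (j.1 + 1) * r j = 2 * s)

/-- The coefficient `2·s!/(r_1!⋯r_s!)`. -/
noncomputable def coeffR (s : ℕ) (r : Fin s → ℕ) : ℝ :=
  2 * (Nat.factorial s : ℝ) / ∏ j, ((r j).factorial : ℝ)

/-- The limiting moment sequence built from `(Λ_k)`. -/
noncomputable def mSeq (Λ : ℕ → ℝ) : ℕ → ℝ := fun k =>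
  if k = 0 then 1
  else if k % 2 = 1 then 0
  else ∑ r ∈ Rset (k / 2), coeffR (k / 2) r * ∏ j : Fin (k / 2), Λ (j.1 + 1) ^ r j

open ProbabilityTheory
open scoped Topology Nat

lemma Rset_nonempty (n : ℕ) : (Rset (n + 1)).Nonempty := by
  refine ⟨Pi.single 0 (n + 1) + Pi.single (Fin.last n) 1, ?_⟩
  simp only [Rset, Finset.mem_filter, Finset.Nat.mem_antidiagonalTuple, Pi.add_apply,
    Finset.sum_add_distrib, mul_add, Finset.sum_pi_single', Finset.mem_univ, if_true]
  refine ⟨trivial, ?_⟩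
  simp only [Pi.single_apply, mul_ite, mul_zero, Finset.sum_ite_eq', Finset.mem_univ, if_true]
  simp
  ring

lemma mSeq_two_mul (Λ : ℕ → ℝ) {s : ℕ} (hs : s ≠ 0) :
    mSeq Λ (2 * s) = ∑ r ∈ Rset s, coeffR s r * ∏ j : Fin s, Λ (j.1 + 1) ^ r j := by
  have h : 2 * s / 2 = s := by omega
  simp only [mSeq, mul_eq_zero, hs, OfNat.ofNat_ne_zero, or_self, if_false, Nat.mul_mod_right,
    zero_ne_one]
  rw [h]

lemma mSeq_two_mul_pos {Λ : ℕ → ℝ} (hΛ : ∀ k, 1 ≤ k → 0 < Λ k) {s : ℕ} (hs : s ≠ 0) :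
    0 < mSeq Λ (2 * s) := by
  obtain ⟨n, rfl⟩ := Nat.exists_eq_succ_of_ne_zero hs
  rw [mSeq_two_mul Λ hs]
  refine Finset.sum_pos (fun r _ ↦ mul_pos ?_ ?_) (Rset_nonempty n)
  · unfold coeffR
    positivity
  · exact Finset.prod_pos fun j _ ↦ pow_pos (hΛ _ (by omega)) _

lemma sum_coeffR_le (s : ℕ) : ∑ r ∈ Rset s, coeffR s r ≤ 2 * ((2 * s)! : ℝ) := by
  have h (r : Fin s → ℕ) (hr : r ∈ Rset s) :
      coeffR s r ≤ 2 * (Nat.multinomial Finset.univ r : ℝ) := by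
    have hsum : ∑ j, r j = s + 1 := by
      simpa [Finset.Nat.mem_antidiagonalTuple] using (Finset.mem_filter.1 hr).1
    have hspec := Nat.multinomial_spec Finset.univ r
    rw [hsum] at hspec
    have hle : (s ! : ℝ) ≤ ((s + 1)! : ℝ) := by exact_mod_cast Nat.factorial_le (Nat.le_succ s)
    have hP : 0 < ∏ j, ((r j)! : ℝ) := by positivity
    rw [coeffR, div_le_iff₀ hP]
    have : (∏ j, ((r j)! : ℝ)) * (Nat.multinomial Finset.univ r : ℝ) = ((s + 1)! : ℝ) := by
      exact_mod_cast hspec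
    linarith
  have hpow : ∑ r ∈ Finset.Nat.antidiagonalTuple s (s + 1), Nat.multinomial Finset.univ r
      = s ^ (s + 1) := by
    have := Finset.sum_pow_eq_sum_piAntidiag (Finset.univ : Finset (Fin s)) (fun _ ↦ (1 : ℕ)) (s + 1)
    simpa [Finset.piAntidiag_univ_fin_eq_antidiagonalTuple] using this.symm
  have hfac : s ^ (s + 1) ≤ (2 * s)! := calc
    s ^ (s + 1) = s * s ^ s := pow_succ' s s
    _ ≤ s ! * (s + 1) ^ s := by
      gcongr
      · exact Nat.self_le_factorial s
      · exact Nat.le_succ s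
    _ ≤ (s + s)! := Nat.factorial_mul_pow_le_factorial
    _ = (2 * s)! := by rw [two_mul]
  calc ∑ r ∈ Rset s, coeffR s r
      ≤ ∑ r ∈ Rset s, 2 * (Nat.multinomial Finset.univ r : ℝ) := Finset.sum_le_sum h
    _ ≤ ∑ r ∈ Finset.Nat.antidiagonalTuple s (s + 1), 2 * (Nat.multinomial Finset.univ r : ℝ) :=
      Finset.sum_le_sum_of_subset_of_nonneg (Finset.filter_subset _ _)
        fun _ _ _ ↦ by positivity
    _ = 2 * ((s ^ (s + 1) : ℕ) : ℝ) := by rw [← Finset.mul_sum, ← hpow, Nat.cast_sum]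
    _ ≤ 2 * ((2 * s)! : ℝ) := by gcongr

lemma mSeq_two_mul_le {Λ : ℕ → ℝ} (hΛ : ∀ k, 1 ≤ k → 0 < Λ k) {B : ℝ}
    (hB : ∀ k, 1 ≤ k → Λ k ≤ B ^ k) {s : ℕ} (hs : s ≠ 0) :
    mSeq Λ (2 * s) ≤ 2 * (2 * s)! * B ^ (2 * s) := by
  rw [mSeq_two_mul Λ hs]
  have h (r : Fin s → ℕ) (hr : r ∈ Rset s) : ∏ j : Fin s, Λ (j.1 + 1) ^ r j ≤ B ^ (2 * s) := by
    rw [← (Finset.mem_filter.1 hr).2, ← Finset.prod_pow_eq_pow_sum]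
    simp_rw [pow_mul]
    exact Finset.prod_le_prod (fun j _ ↦ (pow_pos (hΛ _ (by omega)) _).le) fun j _ ↦
      pow_le_pow_left₀ (hΛ _ (by omega)).le (hB _ (by omega)) _
  calc _ ≤ ∑ r ∈ Rset s, coeffR s r * B ^ (2 * s) := by
        refine Finset.sum_le_sum fun r hr ↦ mul_le_mul_of_nonneg_left (h r hr) ?_
        unfold coeffR
        positivity
    _ = (∑ r ∈ Rset s, coeffR s r) * B ^ (2 * s) := by rw [Finset.sum_mul]
    _ ≤ _ := mul_le_mul_of_nonneg_right (sum_coeffR_le s) (by rw [pow_mul]; positivity)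

/-- A finite measure whose even moments satisfy `∫ x ^ (2s) ≤ A * (2s)! * B ^ (2s)` has a
moment-generating function that is finite near `0`. -/
lemma zero_mem_interior_integrableExpSet_of_moment_le {μ : Measure ℝ} {A B : ℝ}
    (hB : 0 < B) (hint : ∀ s : ℕ, Integrable (fun x : ℝ ↦ x ^ (2 * s)) μ)
    (hle : ∀ s : ℕ, ∫ x, x ^ (2 * s) ∂μ ≤ A * (2 * s)! * B ^ (2 * s)) :
    0 ∈ interior (integrableExpSet id μ) := by
  refine mem_interior_iff_mem_nhds.2 (mem_of_superset
    (Metric.ball_mem_nhds 0 (inv_pos.2 hB)) fun t ht ↦ ?_)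
  have htB : |t| * B < 1 := by
    rw [mem_ball_zero_iff, Real.norm_eq_abs] at ht
    calc |t| * B < B⁻¹ * B := by gcongr
      _ = 1 := inv_mul_cancel₀ hB.ne'
  have hcosh : Integrable (fun x ↦ Real.cosh (t * x)) μ := by
    refine ⟨by fun_prop, ?_⟩
    have h1 (x : ℝ) : ‖Real.cosh (t * x)‖ₑ
        = ∑' s : ℕ, ENNReal.ofReal ((t * x) ^ (2 * s) / (2 * s)!) := by
      rw [Real.enorm_of_nonneg (Real.cosh_pos _).le, Real.cosh_eq_tsum,
        ENNReal.ofReal_tsum_of_nonneg _ (Real.hasSum_cosh _).summable]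
      intro s
      rw [pow_mul]
      positivity
    rw [HasFiniteIntegral]
    simp_rw [h1]
    rw [lintegral_tsum fun s ↦ by fun_prop]
    have h2 (s : ℕ) : ∫⁻ x, ENNReal.ofReal ((t * x) ^ (2 * s) / (2 * s)!) ∂μ
        ≤ ENNReal.ofReal (A * ((|t| * B) ^ 2) ^ s) := by
      have heq (x : ℝ) : (t * x) ^ (2 * s) / (2 * s)! = t ^ (2 * s) / (2 * s)! * x ^ (2 * s) := by
        rw [mul_pow]; ring
      simp_rw [heq]
      rw [← ofReal_integral_eq_lintegral_ofReal ((hint s).const_mul _)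
        (ae_of_all _ fun x ↦ by simp only [pow_mul, Pi.zero_apply]; positivity), integral_const_mul]
      refine ENNReal.ofReal_le_ofReal ?_
      calc t ^ (2 * s) / (2 * s)! * ∫ x, x ^ (2 * s) ∂μ
          ≤ t ^ (2 * s) / (2 * s)! * (A * (2 * s)! * B ^ (2 * s)) :=
            mul_le_mul_of_nonneg_left (hle s) (by rw [pow_mul]; positivity)
        _ = A * ((|t| * B) ^ 2) ^ s := by
            rw [mul_pow, sq_abs, mul_pow, ← pow_mul, ← pow_mul]
            field_simp
    refine (ENNReal.tsum_le_tsum h2).trans_lt ?_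
    have hsum : Summable fun s : ℕ ↦ A * ((|t| * B) ^ 2) ^ s :=
      (summable_geometric_of_lt_one (by positivity)
        (pow_lt_one₀ (by positivity) htB two_ne_zero)).mul_left A
    exact hsum.tsum_ofReal_lt_top
  refine (hcosh.const_mul 2).mono' (by fun_prop) (ae_of_all _ fun x ↦ ?_)
  rw [Real.norm_eq_abs, Real.abs_exp, Real.cosh_eq, id]
  linarith [Real.exp_pos (-(t * x))]

/-- Two finite measures on `ℝ` with moment-generating functions finite near `0` and with the same
moments are equal. -/
lemma MeasureTheory.Measure.ext_of_integral_pow_eq {μ ν : Measure ℝ} [IsFiniteMeasure μ]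
    [IsFiniteMeasure ν] (hμ : 0 ∈ interior (integrableExpSet id μ))
    (hν : 0 ∈ interior (integrableExpSet id ν))
    (h : ∀ k : ℕ, ∫ x, x ^ k ∂μ = ∫ x, x ^ k ∂ν) : μ = ν := by
  have hμ' : AnalyticAt ℂ (complexMGF id μ) 0 := analyticAt_complexMGF (by simpa using hμ)
  have hν' : AnalyticAt ℂ (complexMGF id ν) 0 := analyticAt_complexMGF (by simpa using hν)
  have hder (k : ℕ) : iteratedDeriv k (complexMGF id μ) 0 = iteratedDeriv k (complexMGF id ν) 0 := by
    rw [iteratedDeriv_complexMGF (by simpa using hμ), iteratedDeriv_complexMGF (by simpa using hν)]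
    simp only [id, zero_mul, Complex.exp_zero, mul_one, ← Complex.ofReal_pow]
    rw [integral_complex_ofReal, integral_complex_ofReal, h k]
  have hev : complexMGF id μ =ᶠ[𝓝 0] complexMGF id ν := by
    have h1 := hμ'.hasFPowerSeriesAt.eventually_hasSum_sub
    have h2 := hν'.hasFPowerSeriesAt.eventually_hasSum_sub
    simp_rw [hder] at h1
    filter_upwards [h1, h2] with z hz1 hz2 using hz1.unique hz2
  set S : Set ℝ := interior (integrableExpSet id μ) ∩ interior (integrableExpSet id ν)
  have hS : Convex ℝ S :=
    convex_integrableExpSet.interior.inter convex_integrableExpSet.interior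
  have hEq : Set.EqOn (complexMGF id μ) (complexMGF id ν) {z | z.re ∈ S} :=
    AnalyticOnNhd.eqOn_of_preconnected_of_eventuallyEq
      (analyticOnNhd_complexMGF.mono fun z hz ↦ hz.1)
      (analyticOnNhd_complexMGF.mono fun z hz ↦ hz.2)
      (hS.linear_preimage Complex.reLm).isPreconnected
      (z₀ := 0) (by simpa using ⟨hμ, hν⟩) hev
  refine Measure.ext_of_charFun (funext fun t ↦ ?_)
  rw [← complexMGF_id_mul_I, ← complexMGF_id_mul_I]
  exact hEq (by simpa using ⟨hμ, hν⟩)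

/-- The power function `x ↦ x ^ k` evaluated at the truncation of `x` to `[-M, M]`, as a bounded
continuous function. -/
noncomputable def truncPow (M : ℝ) (k : ℕ) : BoundedContinuousFunction ℝ ℝ :=
  BoundedContinuousFunction.ofNormedAddCommGroup (fun x ↦ (max (-M) (min x M)) ^ k)
    (by fun_prop) (|M| ^ k) fun x ↦ by
      rw [norm_pow, Real.norm_eq_abs]
      refine pow_le_pow_left₀ (abs_nonneg _) (abs_le.2 ?_) k
      rcases abs_cases M with h | h <;> constructor <;> grind

lemma truncPow_apply (M : ℝ) (k : ℕ) (x : ℝ) :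
    truncPow M k x = (max (-M) (min x M)) ^ k := rfl

lemma abs_truncPow_le {M : ℝ} (hM : 0 ≤ M) (k : ℕ) (x : ℝ) : |truncPow M k x| ≤ |x| ^ k := by
  rw [truncPow_apply, abs_pow]
  refine pow_le_pow_left₀ (abs_nonneg _) (abs_le.2 ?_) k
  rcases abs_cases x with h | h <;> constructor <;> grind

lemma truncPow_eq {M x : ℝ} (h : |x| ≤ M) (k : ℕ) : truncPow M k x = x ^ k := by
  rw [truncPow_apply, min_eq_left (abs_le.1 h).2, max_eq_right (abs_le.1 h).1]

lemma abs_pow_sub_truncPow_le {M : ℝ} (hM : 1 ≤ M) (k : ℕ) (x : ℝ) :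
    |x ^ k - truncPow M k x| ≤ 2 / M * x ^ (2 * (k + 1)) := by
  have hnn : 0 ≤ x ^ (2 * (k + 1)) := by rw [pow_mul]; positivity
  rcases le_or_gt |x| M with h | h
  · rw [truncPow_eq h, sub_self, abs_zero]
    positivity
  · have h1 : |x ^ k - truncPow M k x| ≤ 2 * |x| ^ k := by
      have := abs_sub (x ^ k) (truncPow M k x)
      have := abs_truncPow_le (zero_le_one.trans hM) k x
      rw [← abs_pow] at this ⊢
      linarith
    have h2 : |x| ^ k * M ≤ x ^ (2 * (k + 1)) := calc
      |x| ^ k * M ≤ |x| ^ k * |x| := by gcongr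
      _ = |x| ^ (k + 1) := (pow_succ _ _).symm
      _ ≤ |x| ^ (2 * (k + 1)) := pow_le_pow_right₀ (hM.trans h.le) (by omega)
      _ = x ^ (2 * (k + 1)) := by rw [pow_mul, sq_abs, ← pow_mul]
    have hM0 : 0 < M := by linarith
    rw [div_mul_eq_mul_div, le_div_iff₀ hM0]
    nlinarith

lemma abs_integral_pow_sub_truncPow_le {μ : Measure ℝ} [IsFiniteMeasure μ]
    (hint : ∀ k : ℕ, Integrable (fun x : ℝ ↦ x ^ k) μ) {M C : ℝ} (hM : 1 ≤ M) {k : ℕ}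
    (hC : ∫ x, x ^ (2 * (k + 1)) ∂μ ≤ C) :
    |∫ x, x ^ k ∂μ - ∫ x, truncPow M k x ∂μ| ≤ 2 / M * C := by
  rw [← integral_sub (hint k) ((truncPow M k).integrable μ)]
  calc |∫ x, (x ^ k - truncPow M k x) ∂μ| ≤ ∫ x, 2 / M * x ^ (2 * (k + 1)) ∂μ := by
        rw [← Real.norm_eq_abs]
        exact norm_integral_le_of_norm_le ((hint _).const_mul _)
          (ae_of_all _ fun x ↦ abs_pow_sub_truncPow_le hM k x)
    _ ≤ 2 / M * C := by
      rw [integral_const_mul]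
      gcongr

section WeakLimit

variable {ι : Type*} {l : Filter ι} [l.NeBot] {μ : ι → ProbabilityMeasure ℝ}
  {P : ProbabilityMeasure ℝ}

/-- Upper bounds on even moments pass to weak limits. -/
lemma integrable_pow_and_integral_le_of_tendsto (h : Tendsto μ l (𝓝 P)) {k : ℕ} {C : ℝ}
    (hint : ∀ i, Integrable (fun x : ℝ ↦ x ^ (2 * k)) (μ i : Measure ℝ))
    (hC : ∀ i, ∫ x, x ^ (2 * k) ∂(μ i : Measure ℝ) ≤ C) :
    Integrable (fun x : ℝ ↦ x ^ (2 * k)) (P : Measure ℝ) ∧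
      ∫ x, x ^ (2 * k) ∂(P : Measure ℝ) ≤ C := by
  have hnn (x : ℝ) : 0 ≤ x ^ (2 * k) := by rw [pow_mul]; positivity
  have htn (M x : ℝ) : 0 ≤ truncPow M (2 * k) x := by
    rw [truncPow_apply, pow_mul]; positivity
  have hbound (n : ℕ) : ∫⁻ x, ‖truncPow n (2 * k) x‖ₑ ∂(P : Measure ℝ) ≤ ENNReal.ofReal C := by
    simp_rw [Real.enorm_of_nonneg (htn _ _)]
    rw [← ofReal_integral_eq_lintegral_ofReal ((truncPow n (2 * k)).integrable _)
      (ae_of_all _ (htn n))]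
    refine ENNReal.ofReal_le_ofReal (le_of_tendsto
      (ProbabilityMeasure.tendsto_iff_forall_integral_tendsto.1 h (truncPow n (2 * k)))
      (Eventually.of_forall fun i ↦ (integral_mono ((truncPow n (2 * k)).integrable _)
        (hint i) fun x ↦ ?_).trans (hC i)))
    have := abs_truncPow_le (Nat.cast_nonneg n) (2 * k) x
    rwa [abs_of_nonneg (htn _ _), ← abs_pow, abs_of_nonneg (hnn x)] at this
  have hlim (x : ℝ) : Tendsto (fun n : ℕ ↦ truncPow n (2 * k) x) atTop (𝓝 (x ^ (2 * k))) := by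
    refine tendsto_const_nhds.congr' ?_
    filter_upwards [tendsto_natCast_atTop_atTop.eventually_ge_atTop |x|] with n hn
    exact (truncPow_eq hn _).symm
  have hle : ∫⁻ x, ‖x ^ (2 * k)‖ₑ ∂(P : Measure ℝ) ≤ ENNReal.ofReal C :=
    (lintegral_enorm_le_liminf_of_tendsto (ae_of_all _ hlim)
      fun n ↦ (truncPow n (2 * k)).continuous.measurable.enorm.aemeasurable).trans
      (liminf_le_of_le (by isBoundedDefault) fun b hb ↦ by
        obtain ⟨n, hn⟩ := hb.exists
        exact hn.trans (hbound n))
  have hi : Integrable (fun x : ℝ ↦ x ^ (2 * k)) (P : Measure ℝ) :=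
    ⟨by fun_prop, hle.trans_lt ENNReal.ofReal_lt_top⟩
  refine ⟨hi, ?_⟩
  have hC0 : 0 ≤ C := by
    obtain ⟨i⟩ := l.nonempty_of_neBot
    exact (integral_nonneg hnn).trans (hC i)
  simp_rw [Real.enorm_of_nonneg (hnn _)] at hle
  rwa [← ofReal_integral_eq_lintegral_ofReal hi (ae_of_all _ hnn),
    ENNReal.ofReal_le_ofReal_iff hC0] at hle

lemma integrable_pow_of_even {μ : Measure ℝ} [IsFiniteMeasure μ]
    (h : ∀ k : ℕ, Integrable (fun x : ℝ ↦ x ^ (2 * k)) μ) (k : ℕ) :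
    Integrable (fun x : ℝ ↦ x ^ k) μ := by
  refine ((integrable_const 1).add (h k)).mono' (by fun_prop) (ae_of_all _ fun x ↦ ?_)
  simp only [Pi.add_apply, Real.norm_eq_abs]
  rw [mul_comm 2 k, pow_mul, ← sq_abs]
  nlinarith [sq_nonneg (|x ^ k| - 1)]

/-- If all even moments stay bounded along a weakly convergent family of probability measures, then
all moments converge. -/
lemma tendsto_integral_pow_of_tendsto (h : Tendsto μ l (𝓝 P))
    (hint : ∀ i, ∀ k : ℕ, Integrable (fun x : ℝ ↦ x ^ k) (μ i : Measure ℝ))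
    (hC : ∀ k : ℕ, ∃ C, ∀ i, ∫ x, x ^ (2 * k) ∂(μ i : Measure ℝ) ≤ C) (k : ℕ) :
    Tendsto (fun i ↦ ∫ x, x ^ k ∂(μ i : Measure ℝ)) l (𝓝 (∫ x, x ^ k ∂(P : Measure ℝ))) := by
  have hP := integrable_pow_of_even fun k ↦
    (integrable_pow_and_integral_le_of_tendsto h (fun i ↦ hint i (2 * k)) (hC k).choose_spec).1
  obtain ⟨C, hC⟩ := hC (k + 1)
  have hPC := (integrable_pow_and_integral_le_of_tendsto h (fun i ↦ hint i _) hC).2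
  refine Metric.tendsto_nhds.2 fun ε hε ↦ ?_
  have hlim : Tendsto (fun M : ℝ ↦ 2 / M * C) atTop (𝓝 0) := by
    simpa using (tendsto_const_nhds.div_atTop tendsto_id : Tendsto (fun M : ℝ ↦ 2 / M) atTop
      (𝓝 0)).mul_const C
  obtain ⟨M, hMε, hM⟩ :=
    ((hlim.eventually (gt_mem_nhds (by positivity : 0 < ε / 3))).and (eventually_ge_atTop 1)).exists
  filter_upwards [Metric.tendsto_nhds.1
    (ProbabilityMeasure.tendsto_iff_forall_integral_tendsto.1 h (truncPow M k)) (ε / 3)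
    (by positivity)] with i hi
  rw [Real.dist_eq] at hi ⊢
  have h1 := abs_integral_pow_sub_truncPow_le (hint i) hM (hC i)
  have h2 := abs_integral_pow_sub_truncPow_le hP hM hPC
  rw [abs_lt] at hi ⊢
  rw [abs_le] at h1 h2
  constructor <;> linarith

end WeakLimit

lemma isTightMeasureSet_range_of_integral_sq_le {ι : Type*} {μ : ι → Measure ℝ} {C : ℝ}
    [∀ i, IsFiniteMeasure (μ i)]
    (hint : ∀ i, Integrable (fun x : ℝ ↦ x ^ 2) (μ i)) (hC : ∀ i, ∫ x, x ^ 2 ∂(μ i) ≤ C) :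
    IsTightMeasureSet (Set.range μ) := by
  refine isTightMeasureSet_of_tendsto_measure_norm_gt ?_
  have hlim : Tendsto (fun r : ℝ ↦ ENNReal.ofReal (C / r ^ 2)) atTop (𝓝 0) := by
    simpa using ENNReal.tendsto_ofReal
      ((tendsto_const_nhds (x := C)).div_atTop (tendsto_pow_atTop two_ne_zero))
  refine tendsto_of_tendsto_of_tendsto_of_le_of_le' tendsto_const_nhds hlim
    (Eventually.of_forall fun _ ↦ zero_le) ?_
  filter_upwards [eventually_gt_atTop 0] with r hr
  refine iSup₂_le ?_
  rintro _ ⟨i, rfl⟩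
  have h := mul_meas_ge_le_integral_of_nonneg (ae_of_all _ fun x ↦ sq_nonneg x) (hint i) (r ^ 2)
  rw [← ofReal_measureReal]
  refine ENNReal.ofReal_le_ofReal ?_
  rw [le_div_iff₀ (by positivity), mul_comm]
  refine le_trans ?_ (h.trans (hC i))
  refine mul_le_mul_of_nonneg_left (measureReal_mono (fun x hx ↦ ?_)) (sq_nonneg r)
  rw [Set.mem_ofPred_eq, ← sq_abs x]
  exact pow_le_pow_left₀ hr.le (le_of_lt hx) 2

lemma zero_mem_interior_integrableExpSet_of_integral_pow_eq_mSeq {Λ : ℕ → ℝ}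
    (hΛ : ∀ k, 1 ≤ k → 0 < Λ k) {B : ℝ} (hB0 : 0 < B) (hB : ∀ k, 1 ≤ k → Λ k ≤ B ^ k)
    {G : Measure ℝ} [IsProbabilityMeasure G]
    (hG : ∀ k : ℕ, 1 ≤ k → ∫ x, x ^ k ∂G = mSeq Λ k) :
    0 ∈ interior (integrableExpSet id G) := by
  refine zero_mem_interior_integrableExpSet_of_moment_le (A := 2) hB0 (fun s ↦ ?_) fun s ↦ ?_
  · rcases eq_or_ne s 0 with rfl | hs
    · simp
    · refine Integrable.of_integral_ne_zero ?_
      rw [hG (2 * s) (by omega)]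
      exact (mSeq_two_mul_pos hΛ hs).ne'
  · rcases eq_or_ne s 0 with rfl | hs
    · simp
    · rw [hG (2 * s) (by omega)]
      exact mSeq_two_mul_le hΛ hB hs

/-- **The method of moments for the limiting moment sequence**: if probability measures
`ν_n` have all moments finite, converging to `m_k` for each `k ≥ 1`, then there is a unique
probability measure `F` with moments `m_k`, and `ν_n → F` weakly. -/
theorem method_of_moments (Λ : ℕ → ℝ) (hΛpos : ∀ k, 1 ≤ k → 0 < Λ k)
    (hB : ∃ B : ℝ, 0 < B ∧ ∀ k, 1 ≤ k → Λ k ≤ B ^ k)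
    (ν : ℕ → Measure ℝ) (hν : ∀ n, IsProbabilityMeasure (ν n))
    (hint : ∀ n, ∀ k : ℕ, 1 ≤ k → Integrable (fun x : ℝ => x ^ k) (ν n))
    (hconv : ∀ k : ℕ, 1 ≤ k →
      Tendsto (fun n : ℕ => ∫ x, x ^ k ∂(ν n)) atTop (nhds (mSeq Λ k))) :
    ∃ F : Measure ℝ, IsProbabilityMeasure F ∧
      (∀ k : ℕ, 1 ≤ k → ∫ x, x ^ k ∂F = mSeq Λ k) ∧
      (∀ G : Measure ℝ, IsProbabilityMeasure G →
        (∀ k : ℕ, 1 ≤ k → ∫ x, x ^ k ∂G = mSeq Λ k) → G = F) ∧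
      (∀ f : BoundedContinuousFunction ℝ ℝ,
        Tendsto (fun n : ℕ => ∫ x, f x ∂(ν n)) atTop (nhds (∫ x, f x ∂F))) := by
  obtain ⟨B, hB0, hB⟩ := hB
  have hint' (n k : ℕ) : Integrable (fun x : ℝ ↦ x ^ k) (ν n) := by
    rcases Nat.eq_zero_or_pos k with rfl | hk
    · simp
    · exact hint n k hk
  have hbdd (k : ℕ) : ∃ C, ∀ n, ∫ x, x ^ (2 * k) ∂(ν n) ≤ C := by
    rcases Nat.eq_zero_or_pos k with rfl | hk
    · exact ⟨1, fun n ↦ by simp⟩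
    · obtain ⟨C, hC⟩ := (hconv (2 * k) (by omega)).bddAbove_range
      exact ⟨C, fun n ↦ hC ⟨n, rfl⟩⟩
  have huniq (G H : Measure ℝ) [IsProbabilityMeasure G] [IsProbabilityMeasure H]
      (hG : ∀ k : ℕ, 1 ≤ k → ∫ x, x ^ k ∂G = mSeq Λ k)
      (hH : ∀ k : ℕ, 1 ≤ k → ∫ x, x ^ k ∂H = mSeq Λ k) : G = H :=
    Measure.ext_of_integral_pow_eq
      (zero_mem_interior_integrableExpSet_of_integral_pow_eq_mSeq hΛpos hB0 hB hG)
      (zero_mem_interior_integrableExpSet_of_integral_pow_eq_mSeq hΛpos hB0 hB hH) fun k ↦ by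
        rcases Nat.eq_zero_or_pos k with rfl | hk
        · simp
        · rw [hG k hk, hH k hk]
  let ν' : ℕ → ProbabilityMeasure ℝ := fun n ↦ ⟨ν n, hν n⟩
  have hcompact : IsCompact (closure (Set.range ν')) := by
    refine isCompact_closure_of_isTightMeasureSet ?_
    obtain ⟨C, hC⟩ := hbdd 1
    convert isTightMeasureSet_range_of_integral_sq_le (fun n ↦ hint' n 2) hC
    ext P
    constructor
    · rintro ⟨_, ⟨n, rfl⟩, rfl⟩
      exact ⟨n, rfl⟩
    · rintro ⟨n, rfl⟩
      exact ⟨ν' n, ⟨n, rfl⟩, rfl⟩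
  have hmem (n : ℕ) : ν' n ∈ closure (Set.range ν') := subset_closure ⟨n, rfl⟩
  have hcluster (P : ProbabilityMeasure ℝ) (hP : MapClusterPt P atTop ν') (k : ℕ) (hk : 1 ≤ k) :
      ∫ x, x ^ k ∂(P : Measure ℝ) = mSeq Λ k := by
    obtain ⟨U, hU, hUP⟩ := mapClusterPt_iff_ultrafilter.1 hP
    exact tendsto_nhds_unique (tendsto_integral_pow_of_tendsto hUP hint' hbdd k)
      ((hconv k hk).mono_left hU)
  obtain ⟨F, -, hF⟩ := hcompact.exists_mapClusterPt (f := atTop) (u := ν')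
    (le_principal_iff.2 (mem_map.2 (Eventually.of_forall hmem)))
  have hFm := hcluster F hF
  have hlim : Tendsto ν' atTop (𝓝 F) :=
    hcompact.tendsto_nhds_of_unique_mapClusterPt (Eventually.of_forall hmem) fun P _ hP ↦
      Subtype.ext <|
      have := P.2
      have := F.2
      huniq _ _ (hcluster P hP) hFm
  exact ⟨F, F.2, hFm, fun G _ hG ↦ have := F.2; huniq G F hG hFm,
    ProbabilityMeasure.tendsto_iff_forall_integral_tendsto.1 hlim⟩
end
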